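/- arXiv:2302.13811 — 8 statements merged into one kernel-verified Lean document; each statement's English description precedes it below -/
import Mathlib

section
/- Let u0 and u1 be moment functionals on ℂ[x] with MOPS {P_n} and {R_n} respectively, let λ ≠ 0, and let {S_n} be an MOPS relative to the Sobolev form φ_λ. Assume the relation (3.1): P_{n+1} − σ̃_n P_n − τ̃_{n−1} P_{n−1} = S_{n+1} − μ_n S_n − θ_{n−1} S_{n−1} holds for all n ≥ 0. Then there exist complex sequences d̃_n and ẽ_n with d̃_0 = ẽ_0 = ẽ_{−1} = 0 such that for every n ≥ 0: (n+1)·R_n − d̃_n·R_{n−1} − ẽ_{n−1}·R_{n−2} = P′_{n+1} − σ̃_n·P′_n − τ̃_{n−1}·P′_{n−1}. -/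
open Polynomial

noncomputable section

/-- A monic orthogonal polynomial system (MOPS) relative to a moment functional `u`,
indexed by `ℤ` with the convention `P n = 0` for `n < 0`. -/
def IsMOPS (u : Polynomial ℂ →ₗ[ℂ] ℂ) (P : ℤ → Polynomial ℂ) : Prop :=
  (∀ n : ℤ, n < 0 → P n = 0) ∧
  (∀ n : ℤ, 0 ≤ n → (P n).Monic ∧ (P n).natDegree = n.toNat) ∧
  (∀ m n : ℤ, 0 ≤ m → 0 ≤ n → m ≠ n → u (P m * P n) = 0) ∧
  (∀ n : ℤ, 0 ≤ n → u (P n ^ 2) ≠ 0)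

/-- The Sobolev bilinear form `φ_λ(f,g) = ⟨u0, f·g⟩ + λ·⟨u1, f'·g'⟩`. -/
def sobolev (u0 u1 : Polynomial ℂ →ₗ[ℂ] ℂ) (lam : ℂ) (f g : Polynomial ℂ) : ℂ :=
  u0 (f * g) + lam * u1 (derivative f * derivative g)

/-- An MOPS relative to the Sobolev form `φ_λ`. -/
def IsSobolevMOPS (u0 u1 : Polynomial ℂ →ₗ[ℂ] ℂ) (lam : ℂ) (S : ℤ → Polynomial ℂ) : Prop :=
  (∀ n : ℤ, n < 0 → S n = 0) ∧
  (∀ n : ℤ, 0 ≤ n → (S n).Monic ∧ (S n).natDegree = n.toNat) ∧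
  (∀ m n : ℤ, 0 ≤ m → 0 ≤ n → m ≠ n → sobolev u0 u1 lam (S m) (S n) = 0) ∧
  (∀ n : ℤ, 0 ≤ n → sobolev u0 u1 lam (S n) (S n) ≠ 0)

/-- A functional that kills `F j` for all `j < k` kills every polynomial of degree less than `k`,
if each `F j` is monic of degree `j`. -/
theorem map_eq_zero_of_coeff_eq_zero {F : ℕ → ℂ[X]} (hF : ∀ j, (F j).Monic)
    (hdeg : ∀ j, (F j).natDegree = j) (L : ℂ[X] →ₗ[ℂ] ℂ) (k : ℕ) (hL : ∀ j < k, L (F j) = 0)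
    {g : ℂ[X]} (hg : ∀ m, k ≤ m → g.coeff m = 0) : L g = 0 := by
  induction k generalizing g with
  | zero =>
    have : g = 0 := by ext m; simpa using hg m (Nat.zero_le m)
    simp [this]
  | succ k ih =>
    have key : L (g - g.coeff k • F k) = 0 := by
      refine ih (fun j hj => hL j (by omega)) fun m hm => ?_
      rcases hm.eq_or_lt with rfl | hm
      · have h1 : (F k).coeff k = 1 := by simpa [Monic, leadingCoeff, hdeg k] using hF k
        simp [h1]
      · have h1 : (F k).coeff m = 0 := coeff_eq_zero_of_natDegree_lt (by rw [hdeg]; exact hm)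
        simp [h1, hg m hm]
    simpa [hL k (Nat.lt_succ_self k)] using key

namespace IsMOPS

variable {u : ℂ[X] →ₗ[ℂ] ℂ} {P : ℤ → ℂ[X]}

theorem monic (h : IsMOPS u P) (j : ℕ) : (P j).Monic := (h.2.1 j (by omega)).1

theorem natDegree_eq (h : IsMOPS u P) (j : ℕ) : (P j).natDegree = j := by
  simpa using (h.2.1 j (by omega)).2

theorem coeff_self (h : IsMOPS u P) (j : ℕ) : (P j).coeff j = 1 := by
  simpa [Monic, leadingCoeff, h.natDegree_eq j] using h.monic j

theorem coeff_eq_zero (h : IsMOPS u P) {a : ℤ} {m : ℕ} (ham : a < m) : (P a).coeff m = 0 := by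
  rcases lt_or_ge a 0 with ha | ha
  · simp [h.1 a ha]
  · exact coeff_eq_zero_of_natDegree_lt (by rw [(h.2.1 a ha).2]; omega)

theorem orthogonal (h : IsMOPS u P) {a b : ℤ} (hab : a ≠ b) : u (P a * P b) = 0 := by
  rcases lt_or_ge a 0 with ha | ha
  · simp [h.1 a ha]
  rcases lt_or_ge b 0 with hb | hb
  · simp [h.1 b hb]
  exact h.2.2.1 a b ha hb hab

theorem map_mul_self_ne_zero (h : IsMOPS u P) {a : ℤ} (ha : 0 ≤ a) : u (P a * P a) ≠ 0 := by
  simpa [sq] using h.2.2.2 a ha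

theorem map_mul_eq_zero (h : IsMOPS u P) {a : ℤ} {k : ℕ} (hk : (k : ℤ) ≤ a) {g : ℂ[X]}
    (hg : ∀ m, k ≤ m → g.coeff m = 0) : u (P a * g) = 0 :=
  map_eq_zero_of_coeff_eq_zero h.monic h.natDegree_eq (u ∘ₗ LinearMap.mulLeft ℂ (P a)) k
    (fun j hj => h.orthogonal (by omega)) hg

/-- A polynomial of degree less than `k` orthogonal to `P j` for all `j < k` vanishes. -/
theorem eq_zero_of_orthogonal (h : IsMOPS u P) (k : ℕ) {f : ℂ[X]}
    (hf : ∀ m, k ≤ m → f.coeff m = 0) (hu : ∀ j : ℕ, j < k → u (f * P j) = 0) : f = 0 := by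
  induction k with
  | zero => ext m; simpa using hf m (Nat.zero_le m)
  | succ k ih =>
    have low : ∀ m, k ≤ m → (f - f.coeff k • P k).coeff m = 0 := by
      intro m hm
      rcases hm.eq_or_lt with rfl | hm
      · simp [h.coeff_self]
      · simp [h.coeff_eq_zero (show ((k : ℕ) : ℤ) < m by omega), hf m hm]
    have h1 := h.map_mul_eq_zero le_rfl low
    rw [mul_comm, sub_mul, smul_mul_assoc, map_sub, map_smul, hu k (Nat.lt_succ_self k)] at h1
    have hc : f.coeff k = 0 := by
      simpa [h.map_mul_self_ne_zero (Int.natCast_nonneg k)] using h1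
    refine ih (fun m hm => ?_) fun j hj => hu j (by omega)
    rcases hm.eq_or_lt with rfl | hm
    · exact hc
    · exact hf m hm

end IsMOPS

/-- The Sobolev form with its first argument fixed, as a linear functional. -/
def sobolevLeft (u0 u1 : ℂ[X] →ₗ[ℂ] ℂ) (lam : ℂ) (f : ℂ[X]) : ℂ[X] →ₗ[ℂ] ℂ :=
  u0 ∘ₗ LinearMap.mulLeft ℂ f + lam • (u1 ∘ₗ LinearMap.mulLeft ℂ (derivative f) ∘ₗ derivative)

theorem sobolevLeft_apply (u0 u1 : ℂ[X] →ₗ[ℂ] ℂ) (lam : ℂ) (f g : ℂ[X]) :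
    sobolevLeft u0 u1 lam f g = sobolev u0 u1 lam f g := by
  simp [sobolevLeft, sobolev]

theorem IsSobolevMOPS.sobolev_eq_zero {u0 u1 : ℂ[X] →ₗ[ℂ] ℂ} {lam : ℂ} {S : ℤ → ℂ[X]}
    (h : IsSobolevMOPS u0 u1 lam S) {a : ℤ} {k : ℕ} (hk : (k : ℤ) ≤ a) {g : ℂ[X]}
    (hg : ∀ m, k ≤ m → g.coeff m = 0) : sobolev u0 u1 lam (S a) g = 0 := by
  rw [← sobolevLeft_apply]
  refine map_eq_zero_of_coeff_eq_zero (F := fun j : ℕ => S j) (fun j => (h.2.1 j (by omega)).1)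
    (fun j => by simpa using (h.2.1 j (by omega)).2) _ k (fun j hj => ?_) hg
  rw [sobolevLeft_apply]
  exact h.2.2.1 a j (by omega) (by omega) (by omega)

theorem sobolev_sub_smul_sub_smul (u0 u1 : ℂ[X] →ₗ[ℂ] ℂ) (lam a b : ℂ) (f₁ f₂ f₃ g : ℂ[X]) :
    sobolev u0 u1 lam (f₁ - a • f₂ - b • f₃) g =
      sobolev u0 u1 lam f₁ g - a * sobolev u0 u1 lam f₂ g - b * sobolev u0 u1 lam f₃ g := by
  simp only [sobolev, sub_mul, smul_mul_assoc, map_sub, map_smul,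
    smul_eq_mul]
  ring

/-- If `u1 (f * g') = 0` for all `g` of degree at most `k`, then `u1 (f * h) = 0` for all `h` of
degree less than `k`. -/
theorem map_mul_eq_zero_of_derivative {u1 : ℂ[X] →ₗ[ℂ] ℂ} {f : ℂ[X]} {k : ℕ}
    (hf : ∀ g : ℂ[X], (∀ m, k + 1 ≤ m → g.coeff m = 0) → u1 (f * derivative g) = 0)
    {h : ℂ[X]} (hh : ∀ m, k ≤ m → h.coeff m = 0) : u1 (f * h) = 0 := by
  refine map_eq_zero_of_coeff_eq_zero (F := fun j => X ^ j) (fun j => monic_X_pow j)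
    (fun j => natDegree_X_pow j) (u1 ∘ₗ LinearMap.mulLeft ℂ f) k (fun j hj => ?_) hh
  have h1 := hf (X ^ (j + 1)) fun m hm => by
    rw [coeff_X_pow, if_neg (by omega)]
  have h2 : derivative (X ^ (j + 1) : ℂ[X]) = ((j : ℂ) + 1) • X ^ j := by
    simp [smul_eq_C_mul]
  rw [h2, mul_smul_comm, map_smul, smul_eq_mul] at h1
  exact (mul_eq_zero.mp h1).resolve_left (Nat.cast_add_one_ne_zero j)

/-- Theorem 3.1. -/
theorem stmt0
    (u0 u1 : Polynomial ℂ →ₗ[ℂ] ℂ) (lam : ℂ) (hlam : lam ≠ 0)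
    (P R S : ℤ → Polynomial ℂ)
    (hP : IsMOPS u0 P) (hR : IsMOPS u1 R) (hS : IsSobolevMOPS u0 u1 lam S)
    (σ' τ' μ θ : ℤ → ℂ) (hτ' : τ' (-1) = 0) (hθ : θ (-1) = 0)
    (h31 : ∀ n : ℤ, 0 ≤ n →
      P (n + 1) - σ' n • P n - τ' (n - 1) • P (n - 1)
        = S (n + 1) - μ n • S n - θ (n - 1) • S (n - 1)) :
    ∃ d' e' : ℤ → ℂ, d' 0 = 0 ∧ e' 0 = 0 ∧ e' (-1) = 0 ∧
      ∀ n : ℤ, 0 ≤ n →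
        ((n : ℂ) + 1) • R n - d' n • R (n - 1) - e' (n - 1) • R (n - 2)
          = derivative (P (n + 1)) - σ' n • derivative (P n)
            - τ' (n - 1) • derivative (P (n - 1)) := by
  set Q : ℤ → ℂ[X] := fun n => P (n + 1) - σ' n • P n - τ' (n - 1) • P (n - 1) with hQ
  have dQ (n : ℤ) : derivative (Q n) = derivative (P (n + 1)) - σ' n • derivative (P n)
      - τ' (n - 1) • derivative (P (n - 1)) := by
    simp only [hQ, derivative_sub, derivative_smul]
  have hu0 (n : ℕ) (k : ℕ) (hk : k + 1 ≤ n) (g : ℂ[X]) (hg : ∀ m, k ≤ m → g.coeff m = 0) :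
      u0 (Q n * g) = 0 := by
    simp only [hQ, sub_mul, smul_mul_assoc, map_sub, map_smul]
    rw [hP.map_mul_eq_zero (k := k) (by omega) hg, hP.map_mul_eq_zero (k := k) (by omega) hg,
      hP.map_mul_eq_zero (k := k) (by omega) hg]
    simp
  have hφ (n : ℕ) (k : ℕ) (hk : k + 1 ≤ n) (g : ℂ[X]) (hg : ∀ m, k ≤ m → g.coeff m = 0) :
      sobolev u0 u1 lam (Q n) g = 0 := by
    rw [show Q n = _ from h31 n (by omega), sobolev_sub_smul_sub_smul,
      hS.sobolev_eq_zero (k := k) (by omega) hg, hS.sobolev_eq_zero (k := k) (by omega) hg,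
      hS.sobolev_eq_zero (k := k) (by omega) hg]
    simp
  have hu1 (n j : ℕ) (hj : j + 2 < n) : u1 (derivative (Q n) * R j) = 0 := by
    refine map_mul_eq_zero_of_derivative (k := j + 1) (fun g hg => ?_)
      fun m hm => hR.coeff_eq_zero (by omega)
    have h1 := hφ n (j + 2) (by omega) g hg
    rw [sobolev, hu0 n (j + 2) (by omega) g hg, zero_add] at h1
    exact (mul_eq_zero.mp h1).resolve_left hlam
  refine ⟨fun n => -(u1 (derivative (Q n) * R (n - 1)) / u1 (R (n - 1) * R (n - 1))),
    fun n => -(u1 (derivative (Q (n + 1)) * R (n - 1)) / u1 (R (n - 1) * R (n - 1))),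
    by simp [hR.1 (-1)], by simp [hR.1 (-1)], by simp [hR.1 (-2)], fun n hn => ?_⟩
  lift n to ℕ using hn
  rw [← dQ, ← sub_eq_zero]
  refine hR.eq_zero_of_orthogonal n (fun m hm => ?_) fun j hj => ?_
  · have hlow1 : (R (n - 1)).coeff m = 0 := hR.coeff_eq_zero (by omega)
    have hlow2 : (R (n - 2)).coeff m = 0 := hR.coeff_eq_zero (by omega)
    have hP0 : (P n).coeff (m + 1) = 0 := hP.coeff_eq_zero (by omega)
    have hP1 : (P (n - 1)).coeff (m + 1) = 0 := hP.coeff_eq_zero (by omega)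
    simp only [dQ, coeff_sub, coeff_smul, coeff_derivative, hlow1, hlow2, hP0, hP1]
    rcases hm.eq_or_lt with rfl | hm
    · have h1 : (P (n + 1)).coeff (n + 1) = 1 := by exact_mod_cast hP.coeff_self (n + 1)
      simp [h1, hR.coeff_self]
    · have h1 : (P (n + 1)).coeff (m + 1) = 0 := hP.coeff_eq_zero (by omega)
      have h2 : (R n).coeff m = 0 := hR.coeff_eq_zero (by omega)
      simp [h1, h2]
  · simp only [sub_mul, smul_mul_assoc, map_sub, map_smul, smul_eq_mul]
    rw [hR.orthogonal (show (n : ℤ) ≠ j by omega), sub_add_cancel,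
      show (n : ℤ) - 1 - 1 = n - 2 by ring]
    have hne := hR.map_mul_self_ne_zero (Int.natCast_nonneg j)
    by_cases h1 : j + 1 = n
    · rw [show (n : ℤ) - 1 = j by omega, hR.orthogonal (show (n : ℤ) - 2 ≠ j by omega)]
      field_simp
      ring
    rw [hR.orthogonal (show (n : ℤ) - 1 ≠ j by omega)]
    by_cases h2 : j + 2 = n
    · rw [show (n : ℤ) - 2 = j by omega]
      field_simp
      ring
    · rw [hR.orthogonal (show (n : ℤ) - 2 ≠ j by omega), hu1 n j (by omega)]
      ring
end
end

section
/- Let u0 and u1 be moment functionals on ℂ[x] with MOPS {P_n} and {R_n} respectively, let λ ≠ 0, and let {S_n} be an MOPS relative to the Sobolev form φ_λ. Assume relation (3.1): P_{n+1} − σ̃_n P_n − τ̃_{n−1} P_{n−1} = S_{n+1} − μ_n S_n − θ_{n−1} S_{n−1} for all n ≥ 0. Then for every n ≥ 3 and every k with 0 ≤ k ≤ n−3 one has ⟨u1, (P′_{n+1} − σ̃_n P′_n − τ̃_{n−1} P′_{n−1})·R_k⟩ = 0. -/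
open Polynomial

noncomputable section

/-- A functional vanishing on monic polynomials of each degree below `N` vanishes on every
polynomial of degree below `N`. -/
lemma map_eq_zero_of_degree_lt (L : Polynomial ℂ →ₗ[ℂ] ℂ) (Q : ℕ → Polynomial ℂ)
    (hQ : ∀ n, (Q n).Monic ∧ (Q n).natDegree = n) (N : ℕ) (hL : ∀ m < N, L (Q m) = 0)
    (q : Polynomial ℂ) (hq : q.degree < N) : L q = 0 := by
  induction N generalizing q with
  | zero =>
    have : q = 0 := by simpa using hq
    simp [this]
  | succ N ih =>
    have hdeg : (q - q.coeff N • Q N).degree < N := by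
      rw [degree_lt_iff_coeff_zero] at hq ⊢
      intro m hm
      have hlead : (Q N).coeff N = 1 := by
        simpa [(hQ N).2] using (hQ N).1.coeff_natDegree
      rcases hm.eq_or_lt with rfl | hlt
      · simp [hlead]
      · simp [hq m hlt, coeff_eq_zero_of_natDegree_lt ((hQ N).2.trans_lt hlt)]
    have h := ih (fun m hm => hL m (by lia)) _ hdeg
    simpa [hL N N.lt_succ_self] using h

/-- An MOPS element of degree at least `N` is orthogonal to all polynomials of degree below `N`. -/
lemma IsMOPS.orthogonal_s1 {u : Polynomial ℂ →ₗ[ℂ] ℂ} {P : ℤ → Polynomial ℂ} (hP : IsMOPS u P)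
    {m : ℤ} {N : ℕ} (hm : (N : ℤ) ≤ m) {q : Polynomial ℂ} (hq : q.degree < N) :
    u (P m * q) = 0 := by
  obtain ⟨-, hmonic, horth, -⟩ := hP
  exact map_eq_zero_of_degree_lt (u ∘ₗ LinearMap.mulLeft ℂ (P m)) (fun j => P j)
    (fun j => by simpa using hmonic j (by lia)) N
    (fun j hj => horth m j (by lia) (by lia) (by lia)) q hq

/-- A Sobolev MOPS element of degree at least `N` is Sobolev-orthogonal to all polynomials of
degree below `N`. -/
lemma IsSobolevMOPS.orthogonal_s1 {u0 u1 : Polynomial ℂ →ₗ[ℂ] ℂ} {lam : ℂ}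
    {S : ℤ → Polynomial ℂ} (hS : IsSobolevMOPS u0 u1 lam S)
    {m : ℤ} {N : ℕ} (hm : (N : ℤ) ≤ m) {q : Polynomial ℂ} (hq : q.degree < N) :
    sobolev u0 u1 lam (S m) q = 0 := by
  obtain ⟨-, hmonic, horth, -⟩ := hS
  exact map_eq_zero_of_degree_lt
    (u0 ∘ₗ LinearMap.mulLeft ℂ (S m) +
      lam • (u1 ∘ₗ LinearMap.mulLeft ℂ (derivative (S m)) ∘ₗ derivative)) (fun j => S j)
    (fun j => by simpa using hmonic j (by lia)) N
    (fun j hj => horth m j (by lia) (by lia) (by lia)) q hq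

theorem stmt1
    (u0 u1 : Polynomial ℂ →ₗ[ℂ] ℂ) (lam : ℂ) (hlam : lam ≠ 0)
    (P R S : ℤ → Polynomial ℂ)
    (hP : IsMOPS u0 P) (hR : IsMOPS u1 R) (hS : IsSobolevMOPS u0 u1 lam S)
    (σ' τ' μ θ : ℤ → ℂ) (hτ' : τ' (-1) = 0) (hθ : θ (-1) = 0)
    (h31 : ∀ n : ℤ, 0 ≤ n →
      P (n + 1) - σ' n • P n - τ' (n - 1) • P (n - 1)
        = S (n + 1) - μ n • S n - θ (n - 1) • S (n - 1)) :
    ∀ n : ℤ, 3 ≤ n → ∀ k : ℤ, 0 ≤ k → k ≤ n - 3 →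
      u1 ((derivative (P (n + 1)) - σ' n • derivative (P n)
            - τ' (n - 1) • derivative (P (n - 1))) * R k) = 0 := by
  intro n hn k hk hkn
  set T := P (n + 1) - σ' n • P n - τ' (n - 1) • P (n - 1) with hT
  have hTS := h31 n (by lia)
  obtain ⟨N, rfl⟩ : ∃ N : ℕ, n = N + 1 := ⟨(n - 1).toNat, by lia⟩
  have hu0 (q : Polynomial ℂ) (hq : q.degree < N) : u0 (T * q) = 0 := by
    simp only [hT, sub_mul, smul_mul_assoc, map_sub, map_smul]
    rw [hP.orthogonal_s1 (by lia) hq, hP.orthogonal_s1 (by lia) hq, hP.orthogonal_s1 (by lia) hq]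
    simp
  have hsob (q : Polynomial ℂ) (hq : q.degree < N) : sobolev u0 u1 lam T q = 0 := by
    have h1 := hS.orthogonal_s1 (m := N + 1 + 1) (by lia) hq
    have h2 := hS.orthogonal_s1 (m := N + 1) (by lia) hq
    have h3 := hS.orthogonal_s1 (m := N + 1 - 1) (by lia) hq
    rw [hT, hTS]
    simp only [sobolev, sub_mul, smul_mul_assoc, map_sub,
      map_smul, smul_eq_mul] at h1 h2 h3 ⊢
    linear_combination h1 - μ (N + 1) * h2 - θ (N + 1 - 1) * h3
  have hu1 (q : Polynomial ℂ) (hq : q.degree < N) :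
      u1 (derivative T * derivative q) = 0 := by
    simpa [sobolev, hu0 q hq, hlam] using hsob q hq
  have hpow (j : ℕ) (hj : j < N - 1) : u1 (derivative T * X ^ j) = 0 := by
    have h := hu1 (X ^ (j + 1)) (by rw [degree_X_pow]; exact_mod_cast (by lia : j + 1 < N))
    rw [derivative_X_pow, mul_left_comm, ← smul_eq_C_mul, map_smul, smul_eq_mul] at h
    exact (mul_eq_zero.mp h).resolve_left (by exact_mod_cast j.succ_ne_zero)
  have hRk : (R k).degree < (N - 1 : ℕ) := by
    refine degree_le_natDegree.trans_lt ?_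
    rw [(hR.2.1 k hk).2]
    exact_mod_cast (by lia : k.toNat < N - 1)
  have h := map_eq_zero_of_degree_lt (u1 ∘ₗ LinearMap.mulLeft ℂ (derivative T))
    (fun j => X ^ j) (fun j => ⟨monic_X_pow j, natDegree_X_pow j⟩) (N - 1) hpow (R k) hRk
  simpa only [hT, derivative_sub, derivative_smul, LinearMap.comp_apply,
    LinearMap.mulLeft_apply] using h
end
end

section
/- Let u0 and u1 be moment functionals on ℂ[x] with MOPS {P_n} and {R_n} respectively, let λ ≠ 0, and let {S_n} be an MOPS relative to the Sobolev form φ_λ. Assume relation (3.1): P_{n+1} − σ̃_n P_n − τ̃_{n−1} P_{n−1} = S_{n+1} − μ_n S_n − θ_{n−1} S_{n−1} for all n ≥ 0, and relation (3.3): (n+1)·R_n − d̃_n·R_{n−1} − ẽ_{n−1}·R_{n−2} = P′_{n+1} − σ̃_n·P′_n − τ̃_{n−1}·P′_{n−1} for all n ≥ 0 with d̃_0 = ẽ_0 = ẽ_{−1} = 0. Set p_n = ⟨u0, P_n²⟩, r_n = ⟨u1, R_n²⟩, s_n = φ_λ(S_n, S_n). Then for all n ≥ 1: μ_n·s_n =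 σ̃_n·p_n − (σ̃_{n−1} − μ_{n−1})·τ̃_{n−1}·p_{n−1} + λ·( n·d̃_n·r_{n−1} + ((n−1)·μ_{n−1} − d̃_{n−1})·ẽ_{n−1}·r_{n−2} ). -/
open Polynomial

noncomputable section

namespace IsMOPS

variable {u : Polynomial ℂ →ₗ[ℂ] ℂ} {P : ℤ → Polynomial ℂ}

theorem mul_eq_zero_of_ne (h : IsMOPS u P) {m n : ℤ} (hmn : m ≠ n) : u (P m * P n) = 0 := by
  rcases lt_or_ge m 0 with hm | hm
  · simp [h.1 m hm]
  rcases lt_or_ge n 0 with hn | hn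
  · simp [h.1 n hn]
  exact h.2.2.1 m n hm hn hmn

theorem degree_sub_coeff_smul_lt (h : IsMOPS u P) {k : ℕ} {q : Polynomial ℂ}
    (hq : q.degree < (k + 1 : ℕ)) : (q - q.coeff k • P k).degree < k := by
  obtain ⟨hmonic, hdeg⟩ := h.2.1 k (Int.natCast_nonneg k)
  rw [Int.toNat_natCast] at hdeg
  rw [degree_lt_iff_coeff_zero] at hq ⊢
  intro i hi
  rcases hi.eq_or_lt with rfl | hi
  · have := hmonic.coeff_natDegree
    rw [hdeg] at this
    simp [this]
  · have : (P k).coeff i = 0 := coeff_eq_zero_of_natDegree_lt (by omega)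
    simp [hq i hi, this]

theorem mul_eq_zero_of_degree_lt (h : IsMOPS u P) {k : ℕ} {n : ℤ} (hkn : (k : ℤ) ≤ n)
    {q : Polynomial ℂ} (hq : q.degree < k) : u (P n * q) = 0 := by
  induction k generalizing q with
  | zero =>
    have : q = 0 := by
      ext i
      exact (degree_lt_iff_coeff_zero q 0).1 hq i (Nat.zero_le i)
    simp [this]
  | succ k ih =>
    have hlow := ih (by push_cast at hkn; omega) (h.degree_sub_coeff_smul_lt hq)
    have hne : u (P n * P k) = 0 := h.mul_eq_zero_of_ne (by push_cast at hkn; omega)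
    simpa [mul_sub, hne] using hlow

theorem mul_eq_coeff_mul (h : IsMOPS u P) {k : ℕ} {q : Polynomial ℂ}
    (hq : q.degree < (k + 1 : ℕ)) : u (P k * q) = q.coeff k * u (P k ^ 2) := by
  have hlow := h.mul_eq_zero_of_degree_lt le_rfl (h.degree_sub_coeff_smul_lt hq)
  rw [mul_sub, map_sub, mul_smul_comm, map_smul, smul_eq_mul, ← pow_two] at hlow
  exact sub_eq_zero.1 hlow

end IsMOPS

theorem degree_derivative_lt_of_degree_lt_succ {q : Polynomial ℂ} {k : ℕ}
    (hq : q.degree < (k + 1 : ℕ)) : (derivative q).degree < k := by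
  rw [degree_lt_iff_coeff_zero] at hq ⊢
  intro i hi
  simp [coeff_derivative, hq (i + 1) (by omega)]

section Sobolev

variable (u0 u1 : Polynomial ℂ →ₗ[ℂ] ℂ) (lam : ℂ)

theorem sobolev_add_right (f g h : Polynomial ℂ) :
    sobolev u0 u1 lam f (g + h) = sobolev u0 u1 lam f g + sobolev u0 u1 lam f h := by
  simp only [sobolev, mul_add, map_add]; ring

theorem sobolev_smul_right (c : ℂ) (f g : Polynomial ℂ) :
    sobolev u0 u1 lam f (c • g) = c * sobolev u0 u1 lam f g := by
  simp only [sobolev, map_smul, mul_smul_comm, smul_eq_mul]; ring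

theorem sobolev_sub_smul_sub_smul_left (a b : ℂ) (f g h k : Polynomial ℂ) :
    sobolev u0 u1 lam (f - a • g - b • h) k
      = sobolev u0 u1 lam f k - a * sobolev u0 u1 lam g k - b * sobolev u0 u1 lam h k := by
  simp only [sobolev, sub_mul, smul_mul_assoc, map_sub, map_smul, smul_eq_mul]
  ring

theorem IsSobolevMOPS.eq_zero_of_ne {u0 u1 : Polynomial ℂ →ₗ[ℂ] ℂ} {lam : ℂ}
    {S : ℤ → Polynomial ℂ} (h : IsSobolevMOPS u0 u1 lam S) {m n : ℤ} (hmn : m ≠ n) :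
    sobolev u0 u1 lam (S m) (S n) = 0 := by
  rcases lt_or_ge m 0 with hm | hm
  · simp [sobolev, h.1 m hm]
  rcases lt_or_ge n 0 with hn | hn
  · simp [sobolev, h.1 n hn]
  exact h.2.2.1 m n hm hn hmn

end Sobolev

theorem stmt3
    (u0 u1 : Polynomial ℂ →ₗ[ℂ] ℂ) (lam : ℂ) (hlam : lam ≠ 0)
    (P R S : ℤ → Polynomial ℂ)
    (hP : IsMOPS u0 P) (hR : IsMOPS u1 R) (hS : IsSobolevMOPS u0 u1 lam S)
    (σ' τ' μ θ : ℤ → ℂ) (hτ' : τ' (-1) = 0) (hθ : θ (-1) = 0)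
    (h31 : ∀ n : ℤ, 0 ≤ n →
      P (n + 1) - σ' n • P n - τ' (n - 1) • P (n - 1)
        = S (n + 1) - μ n • S n - θ (n - 1) • S (n - 1))
    (d' e' : ℤ → ℂ) (hd'0 : d' 0 = 0) (he'0 : e' 0 = 0) (he'm : e' (-1) = 0)
    (h33 : ∀ n : ℤ, 0 ≤ n →
      ((n : ℂ) + 1) • R n - d' n • R (n - 1) - e' (n - 1) • R (n - 2)
        = derivative (P (n + 1)) - σ' n • derivative (P n)
          - τ' (n - 1) • derivative (P (n - 1)))
    (p r s : ℤ → ℂ)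
    (hp : ∀ n : ℤ, p n = u0 (P n ^ 2))
    (hr : ∀ n : ℤ, r n = u1 (R n ^ 2))
    (hs : ∀ n : ℤ, s n = sobolev u0 u1 lam (S n) (S n)) :
    ∀ n : ℤ, 1 ≤ n →
      μ n * s n
        = σ' n * p n - (σ' (n - 1) - μ (n - 1)) * τ' (n - 1) * p (n - 1)
          + lam * ((n : ℂ) * d' n * r (n - 1)
              + (((n : ℂ) - 1) * μ (n - 1) - d' (n - 1)) * e' (n - 1) * r (n - 2)) := by
  intro n hn
  obtain ⟨m, rfl⟩ : ∃ m : ℕ, n = m + 1 := ⟨(n - 1).toNat, by omega⟩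
  have hQ := h31 (m + 1) (by omega)
  have hQ' := h31 m (by omega)
  have hD := h33 (m + 1) (by omega)
  have hD' := h33 m (by omega)
  simp only [add_sub_cancel_right, show (m : ℤ) + 1 - 2 = m - 1 by ring] at hQ hQ' hD hD' ⊢
  push_cast at hD hD' ⊢
  set Q := P (m + 1 + 1) - σ' (m + 1) • P (m + 1) - τ' m • P m with hQdef
  set Q₀ := P (m + 1) - σ' m • P m - τ' (m - 1) • P (m - 1) with hQ₀def
  have hdQ : derivative Q = ((m : ℂ) + 1 + 1) • R (m + 1) - d' (m + 1) • R m
      - e' m • R (m - 1) := by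
    rw [hD, hQdef]; simp only [derivative_sub, derivative_smul]
  have hdQ₀ : derivative Q₀ = ((m : ℂ) + 1) • R m - d' m • R (m - 1)
      - e' (m - 1) • R (m - 2) := by
    rw [hD', hQ₀def]; simp only [derivative_sub, derivative_smul]
  obtain ⟨hmonic, hdeg⟩ := hS.2.1 m (Int.natCast_nonneg m)
  rw [Int.toNat_natCast] at hdeg
  have hSm : (S m).degree < (m + 1 : ℕ) := by
    rw [degree_eq_natDegree hmonic.ne_zero, hdeg]
    exact_mod_cast Nat.lt_succ_self m
  have hcoeff : (S m).coeff m = 1 := by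
    have := hmonic.coeff_natDegree
    rwa [hdeg] at this
  have hSm' := degree_derivative_lt_of_degree_lt_succ hSm
  -- `φ(Q, S_{m+1})` and `φ(Q, S_{m-1})` from the expansion of `Q` in the `S`-basis
  have hQS : sobolev u0 u1 lam Q (S (m + 1)) = -(μ (m + 1) * s (m + 1)) := by
    rw [hQ, sobolev_sub_smul_sub_smul_left, hS.eq_zero_of_ne (by omega : (m : ℤ) + 1 + 1 ≠ m + 1),
      hS.eq_zero_of_ne (by omega : (m : ℤ) ≠ m + 1), hs]
    ring
  have hQS₀ : sobolev u0 u1 lam Q (S (m - 1)) = 0 := by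
    rw [hQ, sobolev_sub_smul_sub_smul_left, hS.eq_zero_of_ne (by omega : (m : ℤ) + 1 + 1 ≠ m - 1),
      hS.eq_zero_of_ne (by omega : (m : ℤ) + 1 ≠ m - 1),
      hS.eq_zero_of_ne (by omega : (m : ℤ) ≠ m - 1)]
    ring
  -- `φ(Q, S_m)` from the expansions of `Q` and its derivative in the `P`- and `R`-bases
  have hRS : u1 (R (m - 1) * derivative (S m)) = m * r (m - 1) := by
    rcases m with _ | k
    · simp [hR.1 (-1) (by omega)]
    · have := hR.mul_eq_coeff_mul hSm'
      rw [coeff_derivative, hcoeff] at this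
      rw [show ((k + 1 : ℕ) : ℤ) - 1 = k by omega, this, hr]
      push_cast
      ring
  have hQSm : sobolev u0 u1 lam Q (S m) = -(τ' m * p m) - lam * (e' m * (m * r (m - 1))) := by
    have h2 := hP.mul_eq_zero_of_degree_lt (n := m + 1 + 1) (by push_cast; omega) hSm
    have h1 := hP.mul_eq_zero_of_degree_lt (n := m + 1) (by push_cast; omega) hSm
    have h0 := hP.mul_eq_coeff_mul hSm
    have k1 := hR.mul_eq_zero_of_degree_lt (n := m + 1) (by omega) hSm'
    have k0 := hR.mul_eq_zero_of_degree_lt (n := m) (by omega) hSm'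
    rw [hcoeff] at h0
    rw [sobolev, hdQ, hQdef]
    simp only [sub_mul, smul_mul_assoc, map_sub, map_smul, smul_eq_mul, h2, h1, h0, k1, k0, hRS, hp]
    ring
  have hQQ : sobolev u0 u1 lam Q Q₀ = -(σ' (m + 1) * p (m + 1)) + τ' m * σ' m * p m
      + lam * (-(d' (m + 1) * (m + 1) * r m) + e' m * d' m * r (m - 1)) := by
    rw [sobolev, hdQ, hdQ₀, hQdef, hQ₀def]
    have hPne : ∀ {i j : ℤ}, i ≠ j → u0 (P i * P j) = 0 := hP.mul_eq_zero_of_ne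
    have hRne : ∀ {i j : ℤ}, i ≠ j → u1 (R i * R j) = 0 := hR.mul_eq_zero_of_ne
    simp only [sub_mul, mul_sub, smul_mul_assoc, mul_smul_comm, map_sub, map_smul, smul_eq_mul,
      hp, hr, pow_two]
    rw [hPne (by omega : (m : ℤ) + 1 + 1 ≠ m + 1), hPne (by omega : (m : ℤ) + 1 + 1 ≠ m),
      hPne (by omega : (m : ℤ) + 1 + 1 ≠ m - 1), hPne (by omega : (m : ℤ) + 1 ≠ m),
      hPne (by omega : (m : ℤ) + 1 ≠ m - 1), hPne (by omega : (m : ℤ) ≠ m + 1),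
      hPne (by omega : (m : ℤ) ≠ m - 1), hRne (by omega : (m : ℤ) + 1 ≠ m),
      hRne (by omega : (m : ℤ) + 1 ≠ m - 1), hRne (by omega : (m : ℤ) + 1 ≠ m - 2),
      hRne (by omega : (m : ℤ) ≠ m - 1), hRne (by omega : (m : ℤ) ≠ m - 2),
      hRne (by omega : (m : ℤ) - 1 ≠ m), hRne (by omega : (m : ℤ) - 1 ≠ m - 2)]
    ring
  have hSexp : S (m + 1) = Q₀ + μ m • S m + θ (m - 1) • S (m - 1) := by
    rw [hQ']; abel
  rw [hSexp, sobolev_add_right, sobolev_add_right, sobolev_smul_right, sobolev_smul_right,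
    hQQ, hQSm, hQS₀] at hQS
  linear_combination hQS
end
end

section
/- Let u0 be a moment functional on ℂ[x] with MOPS {P_n}, let λ ≠ 0, and let {S_n} be an MOPS relative to the Sobolev form φ_λ (built from u0 and a moment functional u1). Assume relation (3.1): P_{n+1} − σ̃_n P_n − τ̃_{n−1} P_{n−1} = S_{n+1} − μ_n S_n − θ_{n−1} S_{n−1} for all n ≥ 0. Set p_n = ⟨u0, P_n²⟩. Then for all n ≥ 1: ⟨u0, (P_{n+1} − σ̃_n P_n − τ̃_{n−1} P_{n−1})·S_n⟩ = −σ̃_n·p_n + τ̃_{n−1}·p_{n−1}·(σ̃_{n−1} − μ_{n−1}). -/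
open Polynomial

noncomputable section

/-- `P m` is orthogonal to every polynomial of degree less than `m`. -/
theorem IsMOPS.apply_mul_eq_zero {u : Polynomial ℂ →ₗ[ℂ] ℂ} {P : ℤ → Polynomial ℂ}
    (hP : IsMOPS u P) {k : ℕ} {q : Polynomial ℂ} (hq : q.degree < k) {m : ℤ} (hm : (k : ℤ) ≤ m) :
    u (P m * q) = 0 := by
  induction k generalizing q with
  | zero =>
    have hq0 : q = 0 := by simpa using hq
    simp [hq0]
  | succ k ih =>
    obtain ⟨-, hmonic, horth, -⟩ := hP
    obtain ⟨hk, hdeg⟩ := hmonic k (by omega)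
    rw [Int.toNat_natCast] at hdeg
    rw [degree_lt_iff_coeff_zero] at hq
    have hlow : (q - q.coeff k • P k).degree < k := by
      rw [degree_lt_iff_coeff_zero]
      intro j hj
      rcases hj.eq_or_lt with rfl | hj
      · have hlead : (P k).coeff k = 1 := by
          rw [Monic, leadingCoeff, hdeg] at hk
          exact hk
        simp [hlead]
      · simp [hq j hj, coeff_eq_zero_of_natDegree_lt (hdeg.trans_lt hj)]
    have hsplit : P m * q = P m * (q - q.coeff k • P k) + q.coeff k • (P m * P k) := by
      rw [mul_sub, mul_smul_comm, sub_add_cancel]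
    push_cast at hm
    rw [hsplit, map_add, map_smul, ih hlow (by omega),
      horth m k (by omega) (by omega) (by omega), smul_zero, add_zero]

/-- `⟨u, P n * q⟩ = ⟨u, P n ^ 2⟩` for every monic polynomial `q` of degree `n`. -/
theorem IsMOPS.apply_mul_monic {u : Polynomial ℂ →ₗ[ℂ] ℂ} {P : ℤ → Polynomial ℂ}
    (hP : IsMOPS u P) {n : ℤ} (hn : 0 ≤ n) {q : Polynomial ℂ} (hq : q.Monic)
    (hdeg : q.natDegree = n.toNat) : u (P n * q) = u (P n ^ 2) := by
  obtain ⟨hPn, hPdeg⟩ := hP.2.1 n hn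
  have hlow : (q - P n).degree < n.toNat := by
    rw [← hdeg, ← degree_eq_natDegree hq.ne_zero]
    refine degree_sub_lt_left ?_ hq.ne_zero (hq.leadingCoeff.trans hPn.leadingCoeff.symm)
    rw [degree_eq_natDegree hq.ne_zero, degree_eq_natDegree hPn.ne_zero, hdeg, hPdeg]
  have hzero := hP.apply_mul_eq_zero hlow (m := n) (by omega)
  rw [mul_sub, map_sub, sub_eq_zero] at hzero
  rw [hzero, sq]

theorem stmt4
    (u0 u1 : Polynomial ℂ →ₗ[ℂ] ℂ) (lam : ℂ) (hlam : lam ≠ 0)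
    (P S : ℤ → Polynomial ℂ)
    (hP : IsMOPS u0 P) (hS : IsSobolevMOPS u0 u1 lam S)
    (σ' τ' μ θ : ℤ → ℂ) (hτ' : τ' (-1) = 0) (hθ : θ (-1) = 0)
    (h31 : ∀ n : ℤ, 0 ≤ n →
      P (n + 1) - σ' n • P n - τ' (n - 1) • P (n - 1)
        = S (n + 1) - μ n • S n - θ (n - 1) • S (n - 1))
    (p : ℤ → ℂ) (hp : ∀ n : ℤ, p n = u0 (P n ^ 2)) :
    ∀ n : ℤ, 1 ≤ n →
      u0 ((P (n + 1) - σ' n • P n - τ' (n - 1) • P (n - 1)) * S n)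
        = -(σ' n) * p n + τ' (n - 1) * p (n - 1) * (σ' (n - 1) - μ (n - 1)) := by
  intro n hn
  obtain ⟨hSneg, hSmonic, -, -⟩ := hS
  have hSdeg : ∀ k m : ℤ, k < m → 0 ≤ m → (S k).degree < m.toNat := by
    intro k m hkm hm
    rcases lt_or_ge k 0 with hk | hk
    · simp [hSneg k hk]
    · obtain ⟨hmonic, hdeg⟩ := hSmonic k hk
      rw [degree_eq_natDegree hmonic.ne_zero, hdeg]
      exact_mod_cast (by omega : k.toNat < m.toNat)
  have hPS : ∀ k m : ℤ, k < m → 0 ≤ m → u0 (P m * S k) = 0 := fun k m hkm hm =>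
    hP.apply_mul_eq_zero (hSdeg k m hkm hm) (by omega)
  have hdiag : ∀ m : ℤ, 0 ≤ m → u0 (P m * S m) = p m := fun m hm => by
    rw [hp, hP.apply_mul_monic hm (hSmonic m hm).1 (hSmonic m hm).2]
  have hPP : ∀ k : ℤ, k ≠ n - 1 → u0 (P (n - 1) * P k) = 0 := by
    intro k hk
    rcases lt_or_ge k 0 with hneg | hneg
    · simp [hP.1 k hneg]
    · exact hP.2.2.1 (n - 1) k (by omega) hneg hk.symm
  have hSn : S n = P n - σ' (n - 1) • P (n - 1) - τ' (n - 1 - 1) • P (n - 1 - 1)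
      + μ (n - 1) • S (n - 1) + θ (n - 1 - 1) • S (n - 1 - 1) := by
    have h := h31 (n - 1) (by omega)
    rw [sub_add_cancel] at h
    rw [h]
    abel
  have hoff : u0 (P (n - 1) * S n) = (μ (n - 1) - σ' (n - 1)) * p (n - 1) := by
    rw [hSn]
    simp only [mul_add, mul_sub, mul_smul_comm, map_add, map_sub, map_smul, smul_eq_mul]
    rw [hPP n (by omega), hPP (n - 1 - 1) (by omega), hdiag (n - 1) (by omega),
      hPS (n - 1 - 1) (n - 1) (by omega) (by omega), ← sq, ← hp]
    ring
  simp only [sub_mul, smul_mul_assoc, map_sub, map_smul, smul_eq_mul]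
  rw [hPS n (n + 1) (by omega) (by omega), hdiag n (by omega), hoff]
  ring
end
end

section
/- Let u0 and u1 be moment functionals on ℂ[x] with MOPS {P_n} and {R_n} respectively, let λ ≠ 0, and let {S_n} be an MOPS relative to the Sobolev form φ_λ. Assume relation (3.1): P_{n+1} − σ̃_n P_n − τ̃_{n−1} P_{n−1} = S_{n+1} − μ_n S_n − θ_{n−1} S_{n−1} for all n ≥ 0, and relation (3.3): (n+1)·R_n − d̃_n·R_{n−1} − ẽ_{n−1}·R_{n−2} = P′_{n+1} − σ̃_n·P′_n − τ̃_{n−1}·P′_{n−1} for all n ≥ 0 with d̃_0 = ẽ_0 = ẽ_{−1} = 0. Set r_n = ⟨u1, R_n²⟩. Then for all n ≥ 1: ⟨u1, ((n+1)R_n − d̃_n R_{n−1} − ẽ_{n−1} R_{n−2})·S′_n⟩ = −n·d̃_n·r_{n−1} + d̃_{n−1}·ẽ_{n−1}·r_{n−2} − (n−1)·ẽ_{n−1}·μ_{n−1}·r_{n−2}. -/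
open Polynomial

noncomputable section

/-- Distinct members of an MOPS are orthogonal, negative indices included. -/
theorem IsMOPS.apply_mul_eq_zero_s5 {u : Polynomial ℂ →ₗ[ℂ] ℂ} {R : ℤ → Polynomial ℂ}
    (hR : IsMOPS u R) {m n : ℤ} (hmn : m ≠ n) : u (R m * R n) = 0 := by
  obtain ⟨hneg, -, horth, -⟩ := hR
  rcases lt_or_ge m 0 with hm | hm
  · simp [hneg m hm]
  rcases lt_or_ge n 0 with hn | hn
  · simp [hneg n hn]
  exact horth m n hm hn hmn

/-- The derivative of a Sobolev MOPS vanishes at nonpositive indices. -/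
theorem IsSobolevMOPS.derivative_eq_zero {u0 u1 : Polynomial ℂ →ₗ[ℂ] ℂ} {lam : ℂ}
    {S : ℤ → Polynomial ℂ} (hS : IsSobolevMOPS u0 u1 lam S) {n : ℤ} (hn : n ≤ 0) :
    derivative (S n) = 0 := by
  rcases hn.lt_or_eq with hn | rfl
  · simp [hS.1 n hn]
  · exact derivative_of_natDegree_zero (by simpa using (hS.2.1 0 le_rfl).2)

/-- If `T m` is a combination of `R (m - 1)`, `R (m - 2)`, `R (m - 3)`, `T (m - 1)`, `T (m - 2)`
and `T` vanishes at nonpositive indices, then `R k` is orthogonal to `T m` for `m ≤ k`. -/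
theorem IsMOPS.apply_mul_eq_zero_of_recurrence {u : Polynomial ℂ →ₗ[ℂ] ℂ}
    {R T : ℤ → Polynomial ℂ} (hR : IsMOPS u R) (hT : ∀ m : ℤ, m ≤ 0 → T m = 0)
    {a b c f g : ℤ → ℂ}
    (hrec : ∀ m : ℤ, 1 ≤ m → T m = a m • R (m - 1) - b m • R (m - 2) - c m • R (m - 3)
      + f m • T (m - 1) + g m • T (m - 2))
    {k m : ℤ} (hmk : m ≤ k) : u (R k * T m) = 0 := by
  have key : ∀ N : ℕ, ∀ m : ℤ, m ≤ N → m ≤ k → u (R k * T m) = 0 := by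
    intro N
    induction N with
    | zero => intro m hm _; simp [hT m (by simpa using hm)]
    | succ N ih =>
      intro m hm hmk
      rcases le_or_gt m 0 with h0 | h0
      · simp [hT m h0]
      push_cast at hm
      rw [hrec m h0]
      simp only [mul_add, mul_sub, mul_smul_comm, map_add, map_sub, map_smul,
        hR.apply_mul_eq_zero_s5 (show k ≠ m - 1 by lia), hR.apply_mul_eq_zero_s5 (show k ≠ m - 2 by lia),
        hR.apply_mul_eq_zero_s5 (show k ≠ m - 3 by lia), ih (m - 1) (by lia) (by lia),
        ih (m - 2) (by lia) (by lia), smul_zero, sub_zero, add_zero]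
  exact key m.toNat m m.self_le_toNat hmk

theorem stmt5
    (u0 u1 : Polynomial ℂ →ₗ[ℂ] ℂ) (lam : ℂ) (hlam : lam ≠ 0)
    (P R S : ℤ → Polynomial ℂ)
    (hP : IsMOPS u0 P) (hR : IsMOPS u1 R) (hS : IsSobolevMOPS u0 u1 lam S)
    (σ' τ' μ θ : ℤ → ℂ) (hτ' : τ' (-1) = 0) (hθ : θ (-1) = 0)
    (h31 : ∀ n : ℤ, 0 ≤ n →
      P (n + 1) - σ' n • P n - τ' (n - 1) • P (n - 1)
        = S (n + 1) - μ n • S n - θ (n - 1) • S (n - 1))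
    (d' e' : ℤ → ℂ) (hd'0 : d' 0 = 0) (he'0 : e' 0 = 0) (he'm : e' (-1) = 0)
    (h33 : ∀ n : ℤ, 0 ≤ n →
      ((n : ℂ) + 1) • R n - d' n • R (n - 1) - e' (n - 1) • R (n - 2)
        = derivative (P (n + 1)) - σ' n • derivative (P n)
          - τ' (n - 1) • derivative (P (n - 1)))
    (r : ℤ → ℂ) (hr : ∀ n : ℤ, r n = u1 (R n ^ 2)) :
    ∀ n : ℤ, 1 ≤ n →
      u1 ((((n : ℂ) + 1) • R n - d' n • R (n - 1) - e' (n - 1) • R (n - 2))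
            * derivative (S n))
        = -(n : ℂ) * d' n * r (n - 1) + d' (n - 1) * e' (n - 1) * r (n - 2)
            - ((n : ℂ) - 1) * e' (n - 1) * μ (n - 1) * r (n - 2) := by
  have hrec : ∀ m : ℤ, 1 ≤ m → derivative (S m) =
      (m : ℂ) • R (m - 1) - d' (m - 1) • R (m - 2) - e' (m - 2) • R (m - 3)
      + μ (m - 1) • derivative (S (m - 1)) + θ (m - 2) • derivative (S (m - 2)) := by
    intro m hm
    have hRP := h33 (m - 1) (by lia)
    have hPS := congrArg derivative (h31 (m - 1) (by lia))
    simp only [derivative_sub, derivative_smul, sub_add_cancel,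
      show m - 1 - 1 = m - 2 by ring, show m - 1 - 2 = m - 3 by ring, Int.cast_sub,
      Int.cast_one] at hRP hPS
    rw [hRP, hPS]
    abel
  have hzero : ∀ k m : ℤ, m ≤ k → u1 (R k * derivative (S m)) = 0 := fun k m hmk =>
    hR.apply_mul_eq_zero_of_recurrence (T := fun m => derivative (S m))
      (a := fun m => (m : ℂ)) (b := fun m => d' (m - 1)) (c := fun m => e' (m - 2))
      (f := fun m => μ (m - 1)) (g := fun m => θ (m - 2))
      (fun _ hm => hS.derivative_eq_zero hm) hrec hmk
  have hpred : ∀ m : ℤ, 0 ≤ m → u1 (R (m - 1) * derivative (S m)) = m * r (m - 1) := by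
    intro m hm
    rcases hm.eq_or_lt with rfl | hm
    · simp [hS.derivative_eq_zero le_rfl]
    rw [hrec m hm]
    simp only [mul_add, mul_sub, mul_smul_comm, map_add, map_sub, map_smul,
      hR.apply_mul_eq_zero_s5 (show m - 1 ≠ m - 2 by lia),
      hR.apply_mul_eq_zero_s5 (show m - 1 ≠ m - 3 by lia), hzero (m - 1) (m - 1) le_rfl,
      hzero (m - 1) (m - 2) (by lia), ← sq, ← hr, smul_eq_mul]
    ring
  intro n hn
  have hsecond : u1 (R (n - 2) * derivative (S n)) =
      -d' (n - 1) * r (n - 2) + μ (n - 1) * ((n - 1) * r (n - 2)) := by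
    have hprev := hpred (n - 1) (by lia)
    rw [show n - 1 - 1 = n - 2 by ring] at hprev
    rw [hrec n hn]
    simp only [mul_add, mul_sub, mul_smul_comm, map_add, map_sub, map_smul,
      hR.apply_mul_eq_zero_s5 (show n - 2 ≠ n - 1 by lia),
      hR.apply_mul_eq_zero_s5 (show n - 2 ≠ n - 3 by lia), hzero (n - 2) (n - 2) le_rfl,
      hprev, ← sq, ← hr, smul_eq_mul]
    push_cast
    ring
  simp only [sub_mul, smul_mul_assoc, map_sub, map_smul, hzero n n le_rfl,
    hpred n (by lia), hsecond, smul_eq_mul]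
  ring
end
end

section
/- Let {R_n} be an MOPS relative to a moment functional u1 and {Q_n} an MOPS relative to a moment functional u, with R_0 = 1. Assume relation (3.9): R_n − d_{n−1}R_{n−1} − e_{n−2}R_{n−2} = Q_n − σ_{n−1}Q_{n−1} − τ_{n−2}Q_{n−2} for all n ≥ 0, with d_{−1} = e_{−1} = e_{−2} = σ_{−1} = τ_{−1} = τ_{−2} = 0. Then: ⟨u1, Q_n⟩ = σ_{n−1}⟨u1, Q_{n−1}⟩ + τ_{n−2}⟨u1, Q_{n−2}⟩ for all n ≥ 3; ⟨u1, Q_2⟩ = σ_1⟨u1, Q_1⟩ + (τ_0 − e_0)⟨u1, 1⟩; and ⟨u1, Q_1⟩ = (σ_0 − d_0)⟨u1, 1⟩. -/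
open Polynomial

noncomputable section

/-- The functional of an MOPS starting at `1` annihilates every member of positive index. -/
theorem IsMOPS.apply_eq_zero {u : Polynomial ℂ →ₗ[ℂ] ℂ} {P : ℤ → Polynomial ℂ}
    (hP : IsMOPS u P) (hP0 : P 0 = 1) {n : ℤ} (hn : 0 < n) : u (P n) = 0 := by
  simpa [hP0] using hP.2.2.1 n 0 hn.le le_rfl (ne_of_gt hn)

/-- relations (4.3). -/
theorem stmt11
    (u1 u : Polynomial ℂ →ₗ[ℂ] ℂ)
    (R Q : ℤ → Polynomial ℂ)
    (hR : IsMOPS u1 R) (hQ : IsMOPS u Q) (hR0 : R 0 = 1)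
    (d e σ τ : ℤ → ℂ)
    (hd : d (-1) = 0) (he1 : e (-1) = 0) (he2 : e (-2) = 0)
    (hσ : σ (-1) = 0) (hτ1 : τ (-1) = 0) (hτ2 : τ (-2) = 0)
    (h39 : ∀ n : ℤ, 0 ≤ n →
      R n - d (n - 1) • R (n - 1) - e (n - 2) • R (n - 2)
        = Q n - σ (n - 1) • Q (n - 1) - τ (n - 2) • Q (n - 2)) :
    (∀ n : ℤ, 3 ≤ n →
      u1 (Q n) = σ (n - 1) * u1 (Q (n - 1)) + τ (n - 2) * u1 (Q (n - 2))) ∧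
    u1 (Q 2) = σ 1 * u1 (Q 1) + (τ 0 - e 0) * u1 1 ∧
    u1 (Q 1) = (σ 0 - d 0) * u1 1 := by
  have hQ0 : Q 0 = 1 := by
    simpa [hR.1, hQ.1, hR0] using (h39 0 le_rfl).symm
  have apply_h39 (n : ℤ) (hn : 0 ≤ n) := congrArg u1 (h39 n hn)
  simp only [map_sub, map_smul, smul_eq_mul] at apply_h39
  refine ⟨fun n hn => ?_, ?_, ?_⟩
  · have h := apply_h39 n (by lia)
    rw [hR.apply_eq_zero hR0 (by lia), hR.apply_eq_zero hR0 (by lia),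
      hR.apply_eq_zero hR0 (by lia)] at h
    linear_combination -h
  · have h := apply_h39 2 (by norm_num)
    norm_num [hR0, hQ0, hR.apply_eq_zero hR0] at h
    linear_combination -h
  · have h := apply_h39 1 zero_le_one
    norm_num [hR0, hQ0, hR.1, hQ.1, hR.apply_eq_zero hR0] at h
    linear_combination -h
end
end

section
/- Let u0 and u1 be moment functionals on ℂ[x] with MOPS {P_n} and {R_n} respectively, let λ ≠ 0, and let {S_n} be an MOPS relative to the Sobolev form φ_λ. Assume relation (3.1) holds with τ̃_n = 0 and θ_n = 0 for all n, i.e. P_{n+1} − σ̃_n P_n = S_{n+1} − μ_n S_n for all n ≥ 0. Then {u0, u1} is an extended coherent pair: there exists a complex sequence d̃_n with d̃_0 = 0 such that (n+1)·R_n − d̃_n·R_{n−1} = P′_{n+1} − σ̃_n·P′_n for all n ≥ 0. -/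
open Polynomial

noncomputable section

/-- A linear functional vanishing on the first `k` terms of a monic polynomial sequence
vanishes on all polynomials of degree less than `k`. -/
theorem map_eq_zero_of_coeff_eq_zero_s14 (A : ℕ → Polynomial ℂ)
    (hA : ∀ n, (A n).coeff n = 1 ∧ ∀ i, n < i → (A n).coeff i = 0)
    (L : Polynomial ℂ →ₗ[ℂ] ℂ) (k : ℕ) (hL : ∀ m < k, L (A m) = 0)
    (f : Polynomial ℂ) (hf : ∀ i, k ≤ i → f.coeff i = 0) : L f = 0 := by
  induction k generalizing f with
  | zero =>
    have : f = 0 := by ext i; simpa using hf i (Nat.zero_le i)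
    simp [this]
  | succ k ih =>
    have h := ih (fun m hm => hL m (by omega)) (f - f.coeff k • A k) (by
      intro i hi
      rcases hi.eq_or_lt with rfl | hi
      · simp [(hA k).1]
      · simp [(hA k).2 i hi, hf i hi])
    simpa [hL k (by omega)] using h

/-- A polynomial of degree less than `k` orthogonal to the first `k` orthogonal polynomials
is zero. -/
theorem eq_zero_of_forall_orthogonal (u : Polynomial ℂ →ₗ[ℂ] ℂ) (A : ℕ → Polynomial ℂ)
    (hA : ∀ n, (A n).coeff n = 1 ∧ ∀ i, n < i → (A n).coeff i = 0)
    (horth : ∀ m n, m ≠ n → u (A m * A n) = 0) (hne : ∀ n, u (A n * A n) ≠ 0)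
    (k : ℕ) (f : Polynomial ℂ) (hf : ∀ i, k ≤ i → f.coeff i = 0)
    (hu : ∀ m < k, u (f * A m) = 0) : f = 0 := by
  induction k with
  | zero => ext i; simpa using hf i (Nat.zero_le i)
  | succ k ih =>
    have h := map_eq_zero_of_coeff_eq_zero_s14 A hA (u ∘ₗ LinearMap.mulRight ℂ (A k)) k
      (fun m hm => by simpa using horth m k hm.ne) (f - f.coeff k • A k) (by
        intro i hi
        rcases hi.eq_or_lt with rfl | hi
        · simp [(hA k).1]
        · simp [(hA k).2 i hi, hf i hi])
    have hk : f.coeff k = 0 := by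
      simpa [sub_mul, hu k (by omega), hne k] using h
    refine ih (fun i hi => ?_) (fun m hm => hu m (by omega))
    rcases hi.eq_or_lt with rfl | hi
    · exact hk
    · exact hf i hi

/-- A polynomial of degree at most `k + 1` orthogonal to all polynomials of degree less than `k`
is a combination of the orthogonal polynomials of degrees `k + 1` and `k`. -/
theorem exists_eq_smul_add_smul (u : Polynomial ℂ →ₗ[ℂ] ℂ) (A : ℕ → Polynomial ℂ)
    (hA : ∀ n, (A n).coeff n = 1 ∧ ∀ i, n < i → (A n).coeff i = 0)
    (horth : ∀ m n, m ≠ n → u (A m * A n) = 0) (hne : ∀ n, u (A n * A n) ≠ 0)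
    (k : ℕ) (f : Polynomial ℂ) (hf : ∀ i, k + 1 < i → f.coeff i = 0)
    (hu : ∀ m < k, u (f * A m) = 0) :
    ∃ c : ℂ, f = f.coeff (k + 1) • A (k + 1) + c • A k := by
  refine ⟨u (f * A k) / u (A k * A k), ?_⟩
  rw [← sub_eq_zero]
  refine eq_zero_of_forall_orthogonal u A hA horth hne (k + 1) _ (fun i hi => ?_)
    (fun m hm => ?_)
  · rcases hi.eq_or_lt with rfl | hi
    · simp [(hA (k + 1)).1, (hA k).2 (k + 1)]
    · simp [(hA (k + 1)).2 i hi, (hA k).2 i (by omega), hf i hi]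
  · rcases (Nat.lt_succ_iff.mp hm).eq_or_lt with rfl | hm
    · simp [sub_mul, add_mul, horth (m + 1) m, hne m]
    · simp [sub_mul, add_mul, horth (k + 1) m (by omega), horth k m (by omega), hu m hm]

theorem coeff_of_monic_of_natDegree_eq {p : Polynomial ℂ} {n : ℕ}
    (h : p.Monic ∧ p.natDegree = n) : p.coeff n = 1 ∧ ∀ i, n < i → p.coeff i = 0 := by
  obtain ⟨hm, rfl⟩ := h
  exact ⟨hm, fun i hi => coeff_eq_zero_of_natDegree_lt hi⟩

/-- extended coherent pair case. -/
theorem stmt14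
    (u0 u1 : Polynomial ℂ →ₗ[ℂ] ℂ) (lam : ℂ) (hlam : lam ≠ 0)
    (P R S : ℤ → Polynomial ℂ)
    (hP : IsMOPS u0 P) (hR : IsMOPS u1 R) (hS : IsSobolevMOPS u0 u1 lam S)
    (σ' μ : ℤ → ℂ)
    (h31 : ∀ n : ℤ, 0 ≤ n →
      P (n + 1) - σ' n • P n = S (n + 1) - μ n • S n) :
    ∃ d' : ℤ → ℂ, d' 0 = 0 ∧
      ∀ n : ℤ, 0 ≤ n →
        ((n : ℂ) + 1) • R n - d' n • R (n - 1)
          = derivative (P (n + 1)) - σ' n • derivative (P n) := by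
  obtain ⟨-, hPm, hPo, -⟩ := hP
  obtain ⟨-, hRm, hRo, hRn⟩ := hR
  obtain ⟨-, hSm, hSo, -⟩ := hS
  have hPc (n : ℕ) := coeff_of_monic_of_natDegree_eq (n := n) (by simpa using hPm n (by simp))
  have hRc (n : ℕ) := coeff_of_monic_of_natDegree_eq (n := n) (by simpa using hRm n (by simp))
  have hSc (n : ℕ) := coeff_of_monic_of_natDegree_eq (n := n) (by simpa using hSm n (by simp))
  have hRorth : ∀ m n : ℕ, m ≠ n → u1 (R m * R n) = 0 := fun m n hmn =>
    hRo m n (by simp) (by simp) (by exact_mod_cast hmn)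
  have hRne : ∀ n : ℕ, u1 (R n * R n) ≠ 0 := fun n => by
    simpa [pow_two] using hRn n (by simp)
  have hQcoeff (n : ℕ) : (derivative (P (n + 1) - σ' n • P n)).coeff n = (n : ℂ) + 1 ∧
      ∀ i, n < i → (derivative (P (n + 1) - σ' n • P n)).coeff i = 0 := by
    have h1 := hPc (n + 1)
    have h2 := hPc n
    push_cast at h1
    refine ⟨?_, fun i hi => ?_⟩
    · simp [coeff_derivative, h1.1, h2.2]
    · simp [coeff_derivative, h1.2 (i + 1) (by omega), h2.2 (i + 1) (by omega)]
  have hsob (n : ℕ) (g : Polynomial ℂ) (hg : ∀ i, n ≤ i → g.coeff i = 0) :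
      u1 (derivative (P (n + 1) - σ' n • P n) * derivative g) = 0 := by
    set Q := P (n + 1) - σ' n • P n with hQ
    have h0 : u0 (Q * g) = 0 :=
      map_eq_zero_of_coeff_eq_zero_s14 (fun n => P n) hPc (u0 ∘ₗ LinearMap.mulLeft ℂ Q) n
        (fun m hm => by
          simp [hQ, sub_mul, hPo (n + 1) m (by omega) (by omega) (by omega),
            hPo n m (by omega) (by omega) (by omega)]) g hg
    have h1 : u0 (Q * g) + lam * u1 (derivative Q * derivative g) = 0 :=
      map_eq_zero_of_coeff_eq_zero_s14 (fun n => S n) hSc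
        (u0 ∘ₗ LinearMap.mulLeft ℂ Q +
          lam • (u1 ∘ₗ LinearMap.mulLeft ℂ (derivative Q) ∘ₗ derivative)) n
        (fun m hm => by
          have e1 := hSo (n + 1) m (by omega) (by omega) (by omega)
          have e2 := hSo n m (by omega) (by omega) (by omega)
          rw [h31 n (by omega)] at hQ
          simp only [sobolev] at e1 e2
          simp [hQ, sub_mul]
          linear_combination e1 - μ n * e2) g hg
    simpa [h0, hlam] using h1
  have key (n : ℕ) : ∃ d : ℂ, (n = 0 → d = 0) ∧
      ((n : ℂ) + 1) • R n - d • R ((n : ℤ) - 1) = derivative (P (n + 1) - σ' n • P n) := by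
    obtain _ | k := n
    · refine ⟨0, fun _ => rfl, ?_⟩
      rw [← sub_eq_zero]
      ext i
      have hr := hRc 0
      have hq := hQcoeff 0
      rw [zero_smul, sub_zero, coeff_sub, coeff_smul]
      obtain rfl | hi := Nat.eq_zero_or_pos i
      · rw [hr.1, hq.1]; simp
      · rw [hr.2 i hi, hq.2 i hi]; simp
    · have hu : ∀ m < k, u1 (derivative (P ((k + 1 : ℕ) + 1) - σ' (k + 1 : ℕ) • P (k + 1 : ℕ))
          * R m) = 0 := by
        intro m hm
        refine map_eq_zero_of_coeff_eq_zero_s14 (fun n => X ^ n)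
          (fun n => ⟨by simp, fun i hi => by simp [coeff_X_pow, hi.ne']⟩)
          (u1 ∘ₗ LinearMap.mulLeft ℂ _) k (fun j hj => ?_) (R m)
          (fun i hi => (hRc m).2 i (by omega))
        have h := hsob (k + 1) ((((j : ℂ) + 1)⁻¹) • X ^ (j + 1)) (fun i hi => by
          have : i ≠ j + 1 := by omega
          simp [coeff_X_pow, this])
        have hj0 : (j : ℂ) + 1 ≠ 0 := Nat.cast_add_one_ne_zero j
        have hd : derivative ((((j : ℂ) + 1)⁻¹) • (X : Polynomial ℂ) ^ (j + 1)) = X ^ j := by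
          rw [derivative_smul, derivative_X_pow, ← smul_eq_C_mul, smul_smul]
          simp [hj0]
        rw [hd] at h
        exact h
      obtain ⟨c, hc⟩ := exists_eq_smul_add_smul u1 (fun n => R n) hRc hRorth hRne k _
        (hQcoeff (k + 1)).2 hu
      refine ⟨-c, by simp, ?_⟩
      rw [(hQcoeff (k + 1)).1] at hc
      rw [hc]
      simp
  choose d hd0 hd using key
  refine ⟨fun n => d n.toNat, hd0 0 rfl, fun n hn => ?_⟩
  lift n to ℕ using hn
  simpa using hd n
end
end

section
/- Let v and u be moment functionals on ℂ[x] with MOPS's {R_n} and {Q_n} respectively, related by relation (3.9): R_n − d_{n−1}R_{n−1} − e_{n−2}R_{n−2} = Q_n − σ_{n−1}Q_{n−1} − τ_{n−2}Q_{n−2} for all n ≥ 0 (all index-(−1), (−2) coefficients zero), and assume e_n·τ_n ≠ 0 for all n ≥ 0. Then there exist polynomials A(x) and D(x), each of degree 2, such that A(x)·v = D(x)·u as moment functionals, i.e. ⟨v, A·p⟩ = ⟨u, D·p⟩ for every polynomial p. -/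
open Polynomial

noncomputable section

/-- A linear functional vanishing on monic polynomials of each degree below `m` vanishes on
every polynomial of degree below `m`. -/
theorem eq_zero_of_forall_monic_eq_zero (f : ℂ[X] →ₗ[ℂ] ℂ) (S : ℕ → ℂ[X])
    (hS : ∀ i, (S i).Monic ∧ (S i).natDegree = i) (m : ℕ) (hf : ∀ i < m, f (S i) = 0)
    (p : ℂ[X]) (hp : p.degree < m) : f p = 0 := by
  induction m generalizing p with
  | zero =>
    have : p = 0 := by simpa using hp
    simp [this]
  | succ m ih =>
    have hlt : (p - p.coeff m • S m).degree < m := by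
      rw [degree_lt_iff_coeff_zero] at hp ⊢
      intro k hk
      obtain ⟨hmonic, hdeg⟩ := hS m
      rcases hk.eq_or_lt with rfl | hk
      · have : (S m).coeff m = 1 := by simpa [hdeg] using hmonic.coeff_natDegree
        simp [this]
      · have : (S m).coeff k = 0 := coeff_eq_zero_of_natDegree_lt (by omega)
        simp [this, hp k hk]
    have := ih (fun i hi => hf i (by omega)) _ hlt
    simpa [hf m (by omega)] using this

namespace IsMOPS

variable {u : ℂ[X] →ₗ[ℂ] ℂ} {P : ℤ → ℂ[X]}

theorem monic_natDegree (h : IsMOPS u P) (i : ℕ) : (P i).Monic ∧ (P i).natDegree = i := by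
  simpa using h.2.1 i (by positivity)

theorem apply_mul_eq_zero_s16 (h : IsMOPS u P) {p : ℂ[X]} {n : ℕ} (hp : p.degree < n) :
    u (p * P n) = 0 := by
  refine eq_zero_of_forall_monic_eq_zero (u ∘ₗ LinearMap.mulRight ℂ (P n)) (fun i => P i)
    h.monic_natDegree n (fun i hi => ?_) p hp
  simpa using h.2.2.1 i n (by positivity) (by positivity) (by exact_mod_cast hi.ne)

theorem apply_mul_natDegree_ne_zero (h : IsMOPS u P) {p : ℂ[X]} (hp : p ≠ 0) :
    u (p * P p.natDegree) ≠ 0 := by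
  obtain ⟨hmonic, hdeg⟩ := h.monic_natDegree p.natDegree
  set S := P p.natDegree
  have hlt : (p - C p.leadingCoeff * S).degree < p.natDegree := by
    rw [← degree_eq_natDegree hp]
    have hlead : p.leadingCoeff ≠ 0 := leadingCoeff_ne_zero.mpr hp
    refine degree_sub_lt_left ?_ hp ?_
    · rw [degree_C_mul hlead, degree_eq_natDegree hp, degree_eq_natDegree hmonic.ne_zero, hdeg]
    · rw [leadingCoeff_mul, hmonic.leadingCoeff, leadingCoeff_C, mul_one]
  have hzero := h.apply_mul_eq_zero_s16 hlt
  have hsq : u (S ^ 2) ≠ 0 := h.2.2.2 p.natDegree (by positivity)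
  have heq : (p - C p.leadingCoeff * S) * S = p * S - p.leadingCoeff • S ^ 2 := by
    rw [smul_eq_C_mul]; ring
  change u ((p - C p.leadingCoeff * S) * S) = 0 at hzero
  rw [heq, map_sub, map_smul, sub_eq_zero] at hzero
  rw [hzero]
  exact smul_ne_zero (leadingCoeff_ne_zero.mpr hp) hsq

variable {a b : ℤ → ℂ}

/-- The combination `P n - a (n - 1) P (n - 1) - b (n - 2) P (n - 2)` is orthogonal to all
polynomials of degree below `n - 2`. -/
theorem apply_mul_combination_eq_zero (h : IsMOPS u P) {p : ℂ[X]} {n : ℕ} (hp : p.degree < n) :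
    u (p * (P (n + 2 : ℕ) - a ((n + 2 : ℕ) - 1) • P ((n + 2 : ℕ) - 1)
      - b ((n + 2 : ℕ) - 2) • P ((n + 2 : ℕ) - 2))) = 0 := by
  have h1 : (((n + 2 : ℕ) : ℤ) - 1) = (n + 1 : ℕ) := by push_cast; ring
  have h2 : (((n + 2 : ℕ) : ℤ) - 2) = n := by push_cast; ring
  have hmono {k : ℕ} (hk : n ≤ k) : u (p * P k) = 0 :=
    h.apply_mul_eq_zero_s16 (hp.trans_le (by exact_mod_cast hk))
  rw [h1, h2, mul_sub, mul_sub, mul_smul_comm, mul_smul_comm, map_sub, map_sub, map_smul, map_smul,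
    hmono (by omega), hmono (by omega), hmono le_rfl]
  simp

theorem apply_mul_combination_ne_zero (h : IsMOPS u P) {p : ℂ[X]} (hp : p ≠ 0)
    (hb : b p.natDegree ≠ 0) :
    u (p * (P (p.natDegree + 2 : ℕ) - a ((p.natDegree + 2 : ℕ) - 1) • P ((p.natDegree + 2 : ℕ) - 1)
      - b ((p.natDegree + 2 : ℕ) - 2) • P ((p.natDegree + 2 : ℕ) - 2))) ≠ 0 := by
  have h1 : (((p.natDegree + 2 : ℕ) : ℤ) - 1) = (p.natDegree + 1 : ℕ) := by push_cast; ring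
  have h2 : (((p.natDegree + 2 : ℕ) : ℤ) - 2) = p.natDegree := by push_cast; ring
  have hlt {k : ℕ} (hk : p.natDegree < k) : u (p * P k) = 0 :=
    h.apply_mul_eq_zero_s16 (degree_le_natDegree.trans_lt (by exact_mod_cast hk))
  rw [h1, h2, mul_sub, mul_sub, mul_smul_comm, mul_smul_comm, map_sub, map_sub, map_smul, map_smul,
    hlt (by omega), hlt (by omega)]
  simpa using ⟨hb, h.apply_mul_natDegree_ne_zero hp⟩

/-- A functional vanishing on all the combinations of consecutive members of a MOPS is zero. -/
theorem eq_zero_of_combination_eq_zero (h : IsMOPS u P) (f : ℂ[X] →ₗ[ℂ] ℂ)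
    (hf : ∀ n : ℕ, f (P n - a (n - 1) • P (n - 1) - b (n - 2) • P (n - 2)) = 0)
    (p : ℂ[X]) : f p = 0 := by
  have hP (n : ℕ) : f (P n) = 0 := by
    induction n using Nat.strong_induction_on with
    | _ n ih =>
      have hprev (k : ℤ) (hk : k < n) : f (P k) = 0 := by
        rcases lt_or_ge k 0 with hneg | hnonneg
        · rw [h.1 k hneg, map_zero]
        · lift k to ℕ using hnonneg
          exact ih k (by exact_mod_cast hk)
      simpa [hprev (n - 1) (by omega), hprev (n - 2) (by omega)] using hf n
  exact eq_zero_of_forall_monic_eq_zero f (fun i => P i) h.monic_natDegree (p.natDegree + 1)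
    (fun i _ => hP i) p (degree_le_natDegree.trans_lt (by exact_mod_cast Nat.lt_succ_self _))

/-- If `p u = q w` and the combinations of the two MOPS's agree, with nonzero last coefficients
on the side of `u`, then `p` has degree at most that of `q`. -/
theorem degree_le_of_apply_mul_eq (h : IsMOPS u P) {w : ℂ[X] →ₗ[ℂ] ℂ} {S : ℤ → ℂ[X]}
    (hw : IsMOPS w S) {c g : ℤ → ℂ}
    (heq : ∀ n : ℤ, 0 ≤ n → P n - a (n - 1) • P (n - 1) - b (n - 2) • P (n - 2)
      = S n - c (n - 1) • S (n - 1) - g (n - 2) • S (n - 2))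
    (hb : ∀ n : ℤ, 0 ≤ n → b n ≠ 0) {p q : ℂ[X]} (hpq : ∀ r, u (p * r) = w (q * r)) :
    p.degree ≤ q.degree := by
  by_contra! hlt
  have hp : p ≠ 0 := by rintro rfl; simp at hlt
  refine h.apply_mul_combination_ne_zero (a := a) hp (hb p.natDegree (by positivity)) ?_
  rw [heq _ (by positivity), hpq]
  exact hw.apply_mul_combination_eq_zero (by rwa [← degree_eq_natDegree hp])

end IsMOPS

/-- Theorem 4.3. -/
theorem stmt16
    (v u : Polynomial ℂ →ₗ[ℂ] ℂ)
    (R Q : ℤ → Polynomial ℂ)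
    (hR : IsMOPS v R) (hQ : IsMOPS u Q)
    (d e σ τ : ℤ → ℂ)
    (hd : d (-1) = 0) (he1 : e (-1) = 0) (he2 : e (-2) = 0)
    (hσ : σ (-1) = 0) (hτ1 : τ (-1) = 0) (hτ2 : τ (-2) = 0)
    (h39 : ∀ n : ℤ, 0 ≤ n →
      R n - d (n - 1) • R (n - 1) - e (n - 2) • R (n - 2)
        = Q n - σ (n - 1) • Q (n - 1) - τ (n - 2) • Q (n - 2))
    (h3term : ∀ n : ℤ, 0 ≤ n → e n * τ n ≠ 0) :
    ∃ A D : Polynomial ℂ, A.degree = 2 ∧ D.degree = 2 ∧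
      ∀ p : Polynomial ℂ, v (A * p) = u (D * p) := by
  obtain ⟨A, D, hne, hA, hD, hAD⟩ : ∃ A D : ℂ[X], (A ≠ 0 ∨ D ≠ 0) ∧ A.degree < (3 : ℕ) ∧
      D.degree < (3 : ℕ) ∧ ∀ p, v (A * p) = u (D * p) := by
    let T : ℕ → ℂ[X] := fun n => R n - d (n - 1) • R (n - 1) - e (n - 2) • R (n - 2)
    let F : degreeLT ℂ 3 × degreeLT ℂ 3 →ₗ[ℂ] (Fin 5 → ℂ) := LinearMap.pi fun i =>
      (v ∘ₗ LinearMap.mulRight ℂ (T i) ∘ₗ (degreeLT ℂ 3).subtype).coprod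
        (-(u ∘ₗ LinearMap.mulRight ℂ (T i) ∘ₗ (degreeLT ℂ 3).subtype))
    have : Module.Finite ℂ (degreeLT ℂ 3) := Module.Finite.equiv (degreeLTEquiv ℂ 3).symm
    have hrank : Module.finrank ℂ (degreeLT ℂ 3) = 3 := by
      rw [(degreeLTEquiv ℂ 3).finrank_eq]; simp
    have hker : LinearMap.ker F ≠ ⊥ :=
      LinearMap.ker_ne_bot_of_finrank_lt (by simp [Module.finrank_prod, hrank])
    obtain ⟨⟨⟨A, hA⟩, ⟨D, hD⟩⟩, hF, hne⟩ := Submodule.exists_mem_ne_zero_of_ne_bot hker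
    rw [mem_degreeLT] at hA hD
    refine ⟨A, D, ?_, hA, hD, fun p => sub_eq_zero.mp ?_⟩
    · by_contra! hzero
      exact hne (by simp [hzero.1, hzero.2])
    · refine hR.eq_zero_of_combination_eq_zero (a := d) (b := e)
        (v ∘ₗ LinearMap.mulLeft ℂ A - u ∘ₗ LinearMap.mulLeft ℂ D) (fun n => ?_) p
      simp only [LinearMap.sub_apply, LinearMap.comp_apply, LinearMap.mulLeft_apply]
      rcases lt_or_ge n 5 with hn | hn
      · have := congrFun (LinearMap.mem_ker.mp hF) ⟨n, hn⟩
        simpa [F, T, sub_eq_add_neg] using this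
      · obtain ⟨k, rfl⟩ : ∃ k, n = k + 2 := ⟨n - 2, by omega⟩
        have hk : ((3 : ℕ) : WithBot ℕ) ≤ (k : ℕ) := by
          exact_mod_cast (by omega : 3 ≤ k)
        rw [hR.apply_mul_combination_eq_zero (hA.trans_le hk), h39 _ (by positivity),
          hQ.apply_mul_combination_eq_zero (hD.trans_le hk), sub_zero]
  have hdeg : A.degree = D.degree :=
    (hR.degree_le_of_apply_mul_eq hQ h39
        (fun n hn => left_ne_zero_of_mul (h3term n hn)) hAD).antisymm
      (hQ.degree_le_of_apply_mul_eq hR (fun n hn => (h39 n hn).symm)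
        (fun n hn => right_ne_zero_of_mul (h3term n hn)) fun r => (hAD r).symm)
  have hA0 : A ≠ 0 := by
    rintro rfl
    have : D = 0 := by simpa using hdeg.symm
    simp [this] at hne
  have hA2 : A.natDegree < 3 := (natDegree_lt_iff_degree_lt hA0).mpr hA
  have hdegree : (A * X ^ (2 - A.natDegree)).degree = 2 := by
    rw [degree_mul, degree_X_pow, degree_eq_natDegree hA0]
    exact_mod_cast (by omega : A.natDegree + (2 - A.natDegree) = 2)
  refine ⟨A * X ^ (2 - A.natDegree), D * X ^ (2 - A.natDegree), hdegree, ?_, fun p => ?_⟩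
  · rw [← hdegree, degree_mul, degree_mul, hdeg]
  · rw [mul_assoc, mul_assoc, hAD]
end
end
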